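/- Let N ≥ 1, let M be an N×N complex matrix, let α be a real number, and let w_xy, w_yx be real numbers with w_xy·w_yx < 0. Let W be the 2N×2N block matrix W = [[M, w_xy·I],[w_yx·I, 0]]. If u ∈ ℂ^N is a nonzero vector with M u = iα·u, then the two numbers λ± = i·(α ± √(α² − 4 w_xy w_yx))/2 are purely imaginary, satisfy λ±² − iα·λ± − w_xy w_yx = 0, and each is an eigenvalue of W with eigenvector (λ±·u, w_yx·u). -/

import Mathlib

open Matrix

/-- If `M u = iα u` with `u ≠ 0`, `α ∈ ℝ`, and `w_xy w_yx < 0`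
(real), then `λ± = i(α ± √(α² − 4 w_xy w_yx))/2` are purely imaginary, satisfy
`λ±² − iα λ± − w_xy w_yx = 0`, and each is an eigenvalue of the block matrix
`W = [[M, w_xy I],[w_yx I, 0]]` with eigenvector `(λ± u, w_yx u)`. -/
theorem stmt6 (N : ℕ) (hN : 1 ≤ N) (M : Matrix (Fin N) (Fin N) ℂ)
    (α : ℝ) (wxy wyx : ℝ) (hw : wxy * wyx < 0)
    (u : Fin N → ℂ) (hu : u ≠ 0)
    (hMu : M.mulVec u = (Complex.I * (α : ℂ)) • u) :
    ∀ s : ℂ,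
      (s = Complex.I * (((α + Real.sqrt (α ^ 2 - 4 * (wxy * wyx))) / 2 : ℝ) : ℂ) ∨
        s = Complex.I * (((α - Real.sqrt (α ^ 2 - 4 * (wxy * wyx))) / 2 : ℝ) : ℂ)) →
      s.re = 0 ∧
      s ^ 2 - Complex.I * (α : ℂ) * s - (wxy : ℂ) * (wyx : ℂ) = 0 ∧
      (Matrix.fromBlocks M ((wxy : ℂ) • (1 : Matrix (Fin N) (Fin N) ℂ))
          ((wyx : ℂ) • (1 : Matrix (Fin N) (Fin N) ℂ))
          (0 : Matrix (Fin N) (Fin N) ℂ)).mulVec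
        (Sum.elim (s • u) ((wyx : ℂ) • u)) =
      s • Sum.elim (s • u) ((wyx : ℂ) • u) := by
  intro s hs
  have hr : Real.sqrt (α ^ 2 - 4 * (wxy * wyx)) ^ 2 = α ^ 2 - 4 * (wxy * wyx) :=
    Real.sq_sqrt (by nlinarith [sq_nonneg α])
  generalize Real.sqrt (α ^ 2 - 4 * (wxy * wyx)) = r at hs hr
  have hr2 : (r : ℂ) ^ 2 = (α : ℂ) ^ 2 - 4 * ((wxy : ℂ) * (wyx : ℂ)) := by
    exact_mod_cast hr
  have hI : Complex.I ^ 2 = -1 := Complex.I_sq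
  have h1 : s.re = 0 := by
    rcases hs with h | h <;> rw [h, Complex.I_mul_re, Complex.ofReal_im, neg_zero]
  have h2 : s ^ 2 - Complex.I * (α : ℂ) * s - (wxy : ℂ) * (wyx : ℂ) = 0 := by
    rcases hs with h | h <;> rw [h] <;> push_cast <;> ring_nf <;> rw [hI, hr2] <;> ring
  refine ⟨h1, h2, ?_⟩
  rw [Matrix.fromBlocks_mulVec]
  ext i
  rcases i with i | i
  · simp [Matrix.mulVec_smul, Matrix.smul_mulVec, hMu]
    linear_combination (-(u i)) * h2
  · simp [Matrix.smul_mulVec]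
    ring
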